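/- Let d ≥ 4 be an even integer. There exists a constant C = C(d) > 0 such that the following holds for every finite field F of odd characteristic and every nontrivial additive character e of F. Let g : F^d → ℂ have support G ⊆ F^d and satisfy 1/2 ≤ |g(x)| ≤ 2 for all x ∈ G. Then ‖ĝ‖_{L²(P,dσ)} ≤ C ( |G|^{1/2} + |G|^{3/4} |F|^{(2-d)/8} + |F|^{(6-d)/16} |G|^{5/8} ). -/

import Mathlib

open Finset

/-- The Fourier transform `ĝ(ξ) = ∑_{x ∈ F^d} g(x) e(−x·ξ)` of `g : F^d → ℂ`, restricted
to the paraboloid `P = {(x̄, x̄·x̄) : x̄ ∈ F^{d-1}} ⊆ F^d` and parameterized by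
`ȳ ∈ F^{d-1}` (i.e. evaluated at `ξ = (ȳ, ȳ·ȳ)`). -/
noncomputable def fourierP {F : Type} [Field F] [Fintype F] {d : ℕ} (e : AddChar F ℂ)
    (g : (Fin (d - 1) → F) × F → ℂ) (y : Fin (d - 1) → F) : ℂ :=
  ∑ x : (Fin (d - 1) → F) × F, g x * e (-(∑ i, x.1 i * y i + x.2 * ∑ i, y i * y i))

/-- `‖ĝ‖_{L²(P,dσ)} = (|F|^{-(d-1)} ∑_{ξ∈P} |ĝ(ξ)|²)^{1/2}`. -/
noncomputable def l2P {F : Type} [Field F] [Fintype F] {d : ℕ} (e : AddChar F ℂ)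
    (g : (Fin (d - 1) → F) × F → ℂ) : ℝ :=
  (((Fintype.card F : ℝ) ^ (d - 1))⁻¹ *
    ∑ y : Fin (d - 1) → F, ‖fourierP e g y‖ ^ 2) ^ ((1 : ℝ) / 2)

theorem AddChar.map_sum_eq_prod_map {A M ι : Type*} [AddCommMonoid A] [CommMonoid M]
    (e : AddChar A M) (s : Finset ι) (f : ι → A) : e (∑ i ∈ s, f i) = ∏ i ∈ s, e (f i) := by
  classical
  induction s using Finset.induction_on with
  | empty => simp
  | insert a s ha ih => rw [Finset.sum_insert ha, Finset.prod_insert ha, e.map_add_eq_mul, ih]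

section CharacterSums

variable {F : Type*} [Field F] [Fintype F] [DecidableEq F]
  {ι : Type*} [Fintype ι] [DecidableEq ι]

open scoped Classical in
/-- Orthogonality of additive characters on `F ^ ι`. -/
theorem sum_addChar_dotProduct {e : AddChar F ℂ} (he : e ≠ 1) (w : ι → F) :
    ∑ b : ι → F, e (b ⬝ᵥ w) = if w = 0 then (Fintype.card F : ℂ) ^ Fintype.card ι else 0 := by
  have h : ∀ b : ι → F, e (b ⬝ᵥ w) = ∏ i, e (b i * w i) := fun b => by
    rw [dotProduct]
    exact AddChar.map_sum_eq_prod_map e _ _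
  simp_rw [h]
  rw [← Fintype.piFinset_univ, ← Finset.prod_univ_sum (fun _ => Finset.univ)
    (fun i x => e (x * w i))]
  simp_rw [AddChar.sum_mulShift _ (AddChar.IsPrimitive.of_ne_one he)]
  split_ifs with hw
  · simp [hw]
  · obtain ⟨i, hi⟩ := Function.ne_iff.mp hw
    exact Finset.prod_eq_zero (Finset.mem_univ i) (by simpa using hi)

/-- The Gauss sum of the quadratic character, with complex values. -/
noncomputable def quadGauss (e : AddChar F ℂ) : ℂ :=
  gaussSum ((quadraticChar F).ringHomComp (Int.castRingHom ℂ)) e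

theorem norm_quadGauss_sq (hF : ringChar F ≠ 2) {e : AddChar F ℂ} (he : e ≠ 1) :
    ‖quadGauss e‖ ^ 2 = Fintype.card F := by
  have hne : (quadraticChar F).ringHomComp (Int.castRingHom ℂ) ≠ 1 :=
    (MulChar.ringHomComp_ne_one_iff (Int.castRingHom ℂ).injective_int).mpr
      (quadraticChar_ne_one hF)
  have h := gaussSum_sq hne ((quadraticChar_isQuadratic F).comp _)
    (AddChar.IsPrimitive.of_ne_one he)
  rw [quadGauss, ← norm_pow, h, norm_mul]
  rcases quadraticChar_dichotomy (F := F) (a := -1) (by simp) with h2 | h2 <;>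
    simp [MulChar.ringHomComp_apply, h2]

theorem sum_addChar_mul_sq (hF : ringChar F ≠ 2) {e : AddChar F ℂ} (he : e ≠ 1) {t : F}
    (ht : t ≠ 0) : ∑ x, e (t * x ^ 2) = (quadraticChar F t : ℂ) * quadGauss e := by
  have hp := AddChar.IsPrimitive.of_ne_one he
  have h1 : ∑ x, e (t * x ^ 2) = ∑ y, ((quadraticChar F y : ℂ) + 1) * e (t * y) := by
    rw [← Finset.sum_fiberwise Finset.univ (fun x : F => x ^ 2)]
    refine Finset.sum_congr rfl fun y _ => ?_
    have h2 := quadraticChar_card_sqrts hF y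
    have h3 : ∀ x ∈ Finset.univ.filter (fun x : F => x ^ 2 = y), e (t * x ^ 2) = e (t * y) := by
      intro x hx
      rw [(Finset.mem_filter.mp hx).2]
    rw [Finset.sum_congr rfl h3, Finset.sum_const, nsmul_eq_mul]
    congr 1
    have h4 : (Finset.univ.filter (fun x : F => x ^ 2 = y)) = {x : F | x ^ 2 = y}.toFinset := by
      ext; simp
    rw [h4]
    exact_mod_cast h2
  have h2 : ∑ y, e (t * y) = 0 := by
    have := AddChar.sum_mulShift t hp
    simp_rw [mul_comm _ t] at this
    rw [this, if_neg ht]; simp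
  rw [h1]
  simp_rw [add_mul, one_mul]
  rw [Finset.sum_add_distrib, h2, add_zero]
  have h3 := gaussSum_mulShift_eq ((quadraticChar F).ringHomComp (Int.castRingHom ℂ)) e
    (Units.mk0 t ht)
  rw [((quadraticChar_isQuadratic F).comp _).inv] at h3
  simpa [gaussSum, quadGauss, MulChar.ringHomComp_apply] using h3

/-- Completing the square in a quadratic exponential sum. -/
theorem sum_addChar_quadratic (hF : ringChar F ≠ 2) {e : AddChar F ℂ} (he : e ≠ 1) {t : F}
    (ht : t ≠ 0) (w : ι → F) :
    ∑ b : ι → F, e (t * (b ⬝ᵥ b) + b ⬝ᵥ w) =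
      ((quadraticChar F t : ℂ) * quadGauss e) ^ Fintype.card ι * e (-(w ⬝ᵥ w) / (4 * t)) := by
  have h2 : (2 : F) ≠ 0 := Ring.two_ne_zero hF
  have h4 : (4 : F) ≠ 0 := by
    have : (4 : F) = 2 * 2 := by norm_num
    rw [this]; exact mul_ne_zero h2 h2
  have h : ∀ b : ι → F, e (t * (b ⬝ᵥ b) + b ⬝ᵥ w) =
      e (-(w ⬝ᵥ w) / (4 * t)) * ∏ i, e (t * (b i + w i / (2 * t)) ^ 2) := fun b => by
    rw [← AddChar.map_sum_eq_prod_map, ← AddChar.map_add_eq_mul]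
    congr 1
    simp only [dotProduct, Finset.mul_sum, neg_div, Finset.sum_div, ← Finset.sum_neg_distrib,
      ← Finset.sum_add_distrib]
    refine Finset.sum_congr rfl fun i _ => ?_
    field_simp
    ring
  simp_rw [h]
  rw [← Finset.mul_sum, ← Fintype.piFinset_univ, ← Finset.prod_univ_sum (fun _ => Finset.univ)
    (fun i x => e (t * (x + w i / (2 * t)) ^ 2)), mul_comm]
  congr 1
  have h5 : ∀ i : ι, ∑ x, e (t * (x + w i / (2 * t)) ^ 2) =
      (quadraticChar F t : ℂ) * quadGauss e := fun i => by
    rw [← sum_addChar_mul_sq hF he ht]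
    exact Equiv.sum_comp (Equiv.addRight (w i / (2 * t))) (fun x => e (t * x ^ 2))
  simp_rw [h5]
  simp

open scoped Classical in
theorem card_linear_system {e : AddChar F ℂ} (he : e ≠ 1) (u v : ι → F) (α β : F) :
    (Fintype.card F : ℂ) ^ 2 *
        (Finset.univ.filter fun b : ι → F => b ⬝ᵥ u = α ∧ b ⬝ᵥ v = β).card =
      (Fintype.card F : ℂ) ^ Fintype.card ι *
        ∑ s : F, ∑ r : F, if s • u + r • v = 0 then e (-(s * α + r * β)) else 0 := by
  have hp := AddChar.IsPrimitive.of_ne_one he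
  have key : ∀ b : ι → F, ∑ s : F, ∑ r : F, e (s * (b ⬝ᵥ u - α)) * e (r * (b ⬝ᵥ v - β)) =
      (Fintype.card F : ℂ) ^ 2 * if b ⬝ᵥ u = α ∧ b ⬝ᵥ v = β then 1 else 0 := fun b => by
    rw [← Finset.sum_mul_sum, AddChar.sum_mulShift _ hp, AddChar.sum_mulShift _ hp]
    by_cases h1 : b ⬝ᵥ u = α <;> by_cases h2 : b ⬝ᵥ v = β <;>
      simp [h1, h2, sub_eq_zero, sq]
  rw [Finset.card_filter]
  push_cast
  rw [Finset.mul_sum]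
  simp_rw [← key]
  rw [Finset.sum_comm, Finset.mul_sum]
  refine Finset.sum_congr rfl fun s _ => ?_
  rw [Finset.sum_comm, Finset.mul_sum]
  refine Finset.sum_congr rfl fun r _ => ?_
  have h : ∀ b : ι → F, e (s * (b ⬝ᵥ u - α)) * e (r * (b ⬝ᵥ v - β)) =
      e (b ⬝ᵥ (s • u + r • v)) * e (-(s * α + r * β)) := fun b => by
    rw [← AddChar.map_add_eq_mul, ← AddChar.map_add_eq_mul, dotProduct_add, dotProduct_smul,
      dotProduct_smul]
    congr 1
    simp only [smul_eq_mul]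
    ring
  simp_rw [h]
  rw [← Finset.sum_mul, sum_addChar_dotProduct he]
  split_ifs <;> simp

open scoped Classical in
/-- In odd dimension, the number of isotropic vectors orthogonal to two isotropic vectors. -/
theorem card_isotropic_system (hF : ringChar F ≠ 2) {e : AddChar F ℂ} (he : e ≠ 1)
    (hι : Odd (Fintype.card ι)) {u v : ι → F} (hu : u ⬝ᵥ u = 0) (hv : v ⬝ᵥ v = 0) :
    (Fintype.card F : ℂ) ^ 3 *
        (Finset.univ.filter fun b : ι → F => b ⬝ᵥ b = 0 ∧ b ⬝ᵥ u = 0 ∧ b ⬝ᵥ v = 0).card =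
      (Fintype.card F : ℂ) ^ Fintype.card ι *
        ∑ s : F, ∑ r : F, if s • u + r • v = 0 then 1 else 0 := by
  have hp := AddChar.IsPrimitive.of_ne_one he
  have h2 : (2 : F) ≠ 0 := Ring.two_ne_zero hF
  have h4 : (4 : F) ≠ 0 := by
    have : (4 : F) = 2 * 2 := by norm_num
    rw [this]; exact mul_ne_zero h2 h2
  have key : ∀ b : ι → F, ∑ t : F, ∑ s : F, ∑ r : F, e (t * (b ⬝ᵥ b) + b ⬝ᵥ (s • u + r • v)) =
      (Fintype.card F : ℂ) ^ 3 * if b ⬝ᵥ b = 0 ∧ b ⬝ᵥ u = 0 ∧ b ⬝ᵥ v = 0 then 1 else 0 := by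
    intro b
    have h : ∀ t s r : F, e (t * (b ⬝ᵥ b) + b ⬝ᵥ (s • u + r • v)) =
        e (t * (b ⬝ᵥ b)) * (e (s * (b ⬝ᵥ u)) * e (r * (b ⬝ᵥ v))) := fun t s r => by
      rw [← AddChar.map_add_eq_mul, ← AddChar.map_add_eq_mul, dotProduct_add, dotProduct_smul,
        dotProduct_smul, smul_eq_mul, smul_eq_mul]
    simp_rw [h, ← Finset.mul_sum]
    rw [← Finset.sum_mul, ← Finset.sum_mul, AddChar.sum_mulShift _ hp, AddChar.sum_mulShift _ hp,
      AddChar.sum_mulShift _ hp]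
    by_cases h1 : b ⬝ᵥ u = 0 <;> by_cases h2 : b ⬝ᵥ v = 0 <;> by_cases h3 : b ⬝ᵥ b = 0 <;>
      simp [h1, h2, h3]
    ring
  rw [Finset.card_filter]
  push_cast
  rw [Finset.mul_sum]
  simp_rw [← key]
  rw [Finset.sum_comm, ← Finset.add_sum_erase _ _ (Finset.mem_univ (0 : F))]
  have hzero : ∑ b : ι → F, ∑ s : F, ∑ r : F, e (0 * (b ⬝ᵥ b) + b ⬝ᵥ (s • u + r • v)) =
      (Fintype.card F : ℂ) ^ Fintype.card ι *
        ∑ s : F, ∑ r : F, if s • u + r • v = 0 then 1 else 0 := by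
    rw [Finset.sum_comm, Finset.mul_sum]
    refine Finset.sum_congr rfl fun s _ => ?_
    rw [Finset.sum_comm, Finset.mul_sum]
    refine Finset.sum_congr rfl fun r _ => ?_
    simp_rw [zero_mul, zero_add]
    rw [sum_addChar_dotProduct he]
    split_ifs <;> simp
  have hrest : ∀ t ∈ Finset.univ.erase (0 : F),
      ∑ b : ι → F, ∑ s : F, ∑ r : F, e (t * (b ⬝ᵥ b) + b ⬝ᵥ (s • u + r • v)) =
        (quadraticChar F t : ℂ) *
          (quadGauss e ^ Fintype.card ι * ∑ s : F, ∑ r : F, e (-(s * r * (u ⬝ᵥ v)))) := by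
    intro t ht
    have ht := Finset.ne_of_mem_erase ht
    have hodd : (quadraticChar F t : ℂ) ^ Fintype.card ι = quadraticChar F t := by
      obtain ⟨m, hm⟩ := hι
      have := quadraticChar_sq_one (F := F) ht
      rw [hm, pow_succ, pow_mul, ← Int.cast_pow, this]
      simp
    rw [Finset.sum_comm, ← mul_assoc, Finset.mul_sum,
      ← Equiv.sum_comp (Equiv.mulRight₀ (2 * t) (mul_ne_zero h2 ht))]
    refine Finset.sum_congr rfl fun s _ => ?_
    rw [Finset.sum_comm, Finset.mul_sum]
    refine Finset.sum_congr rfl fun r _ => ?_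
    rw [sum_addChar_quadratic hF he ht, mul_pow, hodd]
    congr 2
    simp only [add_dotProduct, dotProduct_add, smul_dotProduct, dotProduct_smul, hu, hv,
      dotProduct_comm v u, smul_eq_mul, Equiv.mulRight₀_apply]
    field_simp
    ring
  rw [Finset.sum_congr rfl hrest, hzero, ← Finset.sum_mul]
  have hsum : ∑ t ∈ Finset.univ.erase (0 : F), (quadraticChar F t : ℂ) = 0 := by
    rw [Finset.sum_erase _ (by simp)]
    exact_mod_cast quadraticChar_sum_zero hF
  rw [hsum, zero_mul, add_zero]

end CharacterSums

open scoped Classical in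
/-- A second moment bound for incidences: the sets `{b ∈ U | R c b}` have density `1 / q` in `U`
and are nearly pairwise independent. -/
theorem incidence_le {α β : Type*} (R : α → β → Prop) (K : α → Finset α) (A : Finset α)
    {B U : Finset β} (hBU : B ⊆ U) {q k r M : ℝ} (hr : 0 ≤ r)
    (h1 : ∀ c ∈ A, ((U.filter fun b => R c b).card : ℝ) = U.card / q)
    (h2 : ∀ c ∈ A, ∀ c' ∈ A, c' ∉ K c →
      ((U.filter fun b => R c b ∧ R c' b).card : ℝ) ≤ U.card / q ^ 2)
    (h3 : ∀ c ∈ A, ((K c).card : ℝ) ≤ k)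
    (hk : k * (U.card / q) ≤ r ^ 2) (hq : 0 < q) (hA : (A.card : ℝ) ≤ M) (hB : (B.card : ℝ) ≤ M) :
    ∑ c ∈ A, ((B.filter fun b => R c b).card : ℝ) ≤ M ^ 2 / q + r * M := by
  set f : β → ℝ := fun b => ∑ c ∈ A, if R c b then 1 else 0 with hf
  have hM : 0 ≤ M := (Nat.cast_nonneg _).trans hA
  have hsum : ∀ S : Finset β, ∑ b ∈ S, f b = ∑ c ∈ A, ((S.filter fun b => R c b).card : ℝ) := by
    intro S
    rw [hf, Finset.sum_comm]
    refine Finset.sum_congr rfl fun c _ => ?_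
    rw [Finset.card_filter]
    push_cast
    rfl
  have hfirst : ∑ b ∈ U, f b = A.card * (U.card / q) := by
    rw [hsum, Finset.sum_congr rfl h1, Finset.sum_const, nsmul_eq_mul]
  have hsecond : ∑ b ∈ U, f b ^ 2 ≤ (A.card : ℝ) ^ 2 * (U.card / q ^ 2) + A.card * r ^ 2 := by
    have e1 : ∑ b ∈ U, f b ^ 2 =
        ∑ c ∈ A, ∑ c' ∈ A, ((U.filter fun b => R c b ∧ R c' b).card : ℝ) := by
      simp_rw [hf, sq, Finset.sum_mul_sum]
      rw [Finset.sum_comm]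
      refine Finset.sum_congr rfl fun c _ => ?_
      rw [Finset.sum_comm]
      refine Finset.sum_congr rfl fun c' _ => ?_
      rw [Finset.card_filter]
      push_cast
      refine Finset.sum_congr rfl fun b _ => ?_
      by_cases hc : R c b <;> by_cases hc' : R c' b <;> simp [hc, hc']
    have e2 : ∀ c ∈ A, ∑ c' ∈ A, ((U.filter fun b => R c b ∧ R c' b).card : ℝ) ≤
        A.card * (U.card / q ^ 2) + r ^ 2 := by
      intro c hc
      calc ∑ c' ∈ A, ((U.filter fun b => R c b ∧ R c' b).card : ℝ)
          ≤ ∑ c' ∈ A, (U.card / q ^ 2 + (if c' ∈ K c then 1 else 0) * (U.card / q)) := by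
            refine Finset.sum_le_sum fun c' hc' => ?_
            by_cases hb : c' ∈ K c
            · have h4 : ((U.filter fun b => R c b ∧ R c' b).card : ℝ) ≤ U.card / q := by
                rw [← h1 c hc]
                have : (U.filter fun b => R c b ∧ R c' b) ⊆ U.filter fun b => R c b :=
                  Finset.monotone_filter_right _ fun b _ hb => hb.1
                exact_mod_cast Finset.card_le_card this
              have : (0 : ℝ) ≤ U.card / q ^ 2 := by positivity
              simp only [hb, if_true]
              linarith
            · simpa [hb] using h2 c hc c' hc' hb
        _ = A.card * (U.card / q ^ 2) + (A.filter fun c' => c' ∈ K c).card * (U.card / q) := by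
            rw [Finset.sum_add_distrib, Finset.sum_const, nsmul_eq_mul, ← Finset.sum_mul,
              Finset.card_filter]
            push_cast
            rfl
        _ ≤ _ := by
            gcongr
            refine le_trans ?_ hk
            gcongr
            refine le_trans (Nat.cast_le.mpr (Finset.card_le_card fun c' hc' => ?_)) (h3 c hc)
            exact (Finset.mem_filter.mp hc').2
    rw [e1]
    refine (Finset.sum_le_sum e2).trans (le_of_eq ?_)
    rw [Finset.sum_const, nsmul_eq_mul]
    ring
  have hvar : ∑ b ∈ U, (f b - A.card / q) ^ 2 ≤ A.card * r ^ 2 := by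
    have e1 : ∑ b ∈ U, (f b - A.card / q) ^ 2 =
        ∑ b ∈ U, f b ^ 2 - 2 * (A.card / q) * ∑ b ∈ U, f b + U.card * (A.card / q) ^ 2 := by
      rw [Finset.mul_sum, ← Finset.sum_sub_distrib, ← nsmul_eq_mul, ← Finset.sum_const,
        ← Finset.sum_add_distrib]
      exact Finset.sum_congr rfl fun b _ => by ring
    rw [e1, hfirst]
    have e2 : 2 * (A.card / q) * (A.card * (U.card / q)) =
        2 * ((A.card : ℝ) ^ 2 * (U.card / q ^ 2)) := by
      field_simp
    have e3 : U.card * ((A.card : ℝ) / q) ^ 2 = (A.card : ℝ) ^ 2 * (U.card / q ^ 2) := by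
      field_simp
    linarith
  have hdev : ∑ b ∈ B, (f b - A.card / q) ≤ r * M := by
    refine le_of_sq_le_sq ?_ (by positivity)
    calc (∑ b ∈ B, (f b - A.card / q)) ^ 2
        ≤ B.card * ∑ b ∈ B, (f b - A.card / q) ^ 2 := sq_sum_le_card_mul_sum_sq
      _ ≤ B.card * ∑ b ∈ U, (f b - A.card / q) ^ 2 := by
          gcongr
      _ ≤ M * (M * r ^ 2) := by
          gcongr
          exact hvar.trans (by gcongr)
      _ = (r * M) ^ 2 := by ring
  rw [← hsum]
  have e4 : ∑ b ∈ B, f b = ∑ b ∈ B, (f b - A.card / q) + B.card * (A.card / q) := by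
    rw [Finset.sum_sub_distrib, Finset.sum_const, nsmul_eq_mul]
    ring
  have e5 : (B.card : ℝ) * (A.card / q) ≤ M ^ 2 / q := by
    rw [sq, mul_div_assoc]
    gcongr
  linarith

section Counting

variable {F : Type*} [Field F] [Fintype F] {ι : Type*} [Fintype ι]

open scoped Classical in
theorem sum_ite_smul_eq_zero {u : ι → F} (hu : u ≠ 0) :
    ∑ s : F, ∑ r : F, (if s • u + r • (0 : ι → F) = 0 then 1 else 0 : ℂ) = Fintype.card F := by
  simp [hu]

open scoped Classical in
theorem sum_ite_smul_add_smul_eq_zero {u v : ι → F}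
    (h : ∀ s r : F, s • u + r • v = 0 → s = 0 ∧ r = 0) :
    ∑ s : F, ∑ r : F, (if s • u + r • v = 0 then 1 else 0 : ℂ) = 1 := by
  have h' : ∀ s r : F, s • u + r • v = 0 ↔ s = 0 ∧ r = 0 :=
    fun s r => ⟨h s r, by rintro ⟨rfl, rfl⟩; simp⟩
  simp_rw [h', ite_and]
  simp

open scoped Classical in
theorem card_hyperplane {e : AddChar F ℂ} (he : e ≠ 1) {u : ι → F} (hu : u ≠ 0) (α : F) :
    ((Finset.univ.filter fun b : ι → F => b ⬝ᵥ u = α).card : ℝ) =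
      (Fintype.card F : ℝ) ^ Fintype.card ι / Fintype.card F := by
  have h := card_linear_system he u 0 α 0
  have h' : ∀ s r : F, (if s • u + r • (0 : ι → F) = 0 then e (-(s * α + r * 0)) else 0) =
      if s • u + r • (0 : ι → F) = 0 then 1 else 0 := by
    intro s r
    split_ifs with h0
    · have : s = 0 := by simpa [hu] using h0
      simp [this]
    · rfl
  simp_rw [h', sum_ite_smul_eq_zero hu] at h
  have hq : (Fintype.card F : ℝ) ≠ 0 := by simp
  have h2 : (Fintype.card F : ℝ) ^ 2 *
      (Finset.univ.filter fun b : ι → F => b ⬝ᵥ u = α).card =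
        (Fintype.card F : ℝ) ^ Fintype.card ι * Fintype.card F := by
    simp only [dotProduct_zero, and_true] at h
    exact_mod_cast h
  field_simp
  refine mul_left_cancel₀ hq ?_
  linear_combination h2

open scoped Classical in
theorem card_hyperplane_inter {e : AddChar F ℂ} (he : e ≠ 1) {u v : ι → F}
    (huv : ∀ s r : F, s • u + r • v = 0 → s = 0 ∧ r = 0) (α β : F) :
    ((Finset.univ.filter fun b : ι → F => b ⬝ᵥ u = α ∧ b ⬝ᵥ v = β).card : ℝ) =
      (Fintype.card F : ℝ) ^ Fintype.card ι / Fintype.card F ^ 2 := by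
  have h := card_linear_system he u v α β
  have h' : ∀ s r : F, (if s • u + r • v = 0 then e (-(s * α + r * β)) else 0) =
      if s • u + r • v = 0 then 1 else 0 := by
    intro s r
    split_ifs with h0
    · obtain ⟨rfl, rfl⟩ := huv s r h0
      simp
    · rfl
  simp_rw [h', sum_ite_smul_add_smul_eq_zero huv] at h
  have hq : (Fintype.card F : ℝ) ≠ 0 := by simp
  have h2 : (Fintype.card F : ℝ) ^ 2 *
      (Finset.univ.filter fun b : ι → F => b ⬝ᵥ u = α ∧ b ⬝ᵥ v = β).card =
        (Fintype.card F : ℝ) ^ Fintype.card ι * 1 := by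
    exact_mod_cast h
  field_simp
  linear_combination h2

theorem card_filter_sub [DecidableEq ι] (P : (ι → F) → Prop) [DecidablePred P] (a : ι → F) :
    (Finset.univ.filter fun b : ι → F => P (b - a)).card =
      (Finset.univ.filter fun b : ι → F => P b).card :=
  Finset.card_nbij' (· - a) (· + a) (by intro b; simp) (by intro b; simp) (by intro b; simp)
    (by intro b; simp)

open scoped Classical in
theorem card_isotropic (hF : ringChar F ≠ 2) {e : AddChar F ℂ} (he : e ≠ 1)
    (hι : Odd (Fintype.card ι)) (a : ι → F) :
    ((Finset.univ.filter fun b : ι → F => (b - a) ⬝ᵥ (b - a) = 0).card : ℝ) =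
      (Fintype.card F : ℝ) ^ Fintype.card ι / Fintype.card F := by
  have hshift : (Finset.univ.filter fun b : ι → F => (b - a) ⬝ᵥ (b - a) = 0).card =
      (Finset.univ.filter fun b : ι → F => b ⬝ᵥ b = 0).card :=
    card_filter_sub (fun b => b ⬝ᵥ b = 0) a
  rw [hshift]
  have h := card_isotropic_system (u := (0 : ι → F)) (v := 0) hF he hι (by simp) (by simp)
  have hq : (Fintype.card F : ℝ) ≠ 0 := by simp
  have h2 : (Fintype.card F : ℝ) ^ 3 * (Finset.univ.filter fun b : ι → F => b ⬝ᵥ b = 0).card =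
        (Fintype.card F : ℝ) ^ Fintype.card ι * (Fintype.card F * Fintype.card F) := by
    simp only [dotProduct_zero, and_true, smul_zero, add_zero, if_true, Finset.sum_const,
      Finset.card_univ, nsmul_eq_mul, mul_one] at h
    exact_mod_cast h
  field_simp
  refine mul_left_cancel₀ (pow_ne_zero 2 hq) ?_
  linear_combination h2

open scoped Classical in
theorem card_isotropic_hyperplane (hF : ringChar F ≠ 2) {e : AddChar F ℂ} (he : e ≠ 1)
    (hι : Odd (Fintype.card ι)) (a : ι → F) {u : ι → F} (hu : u ≠ 0)
    (hu0 : u ⬝ᵥ u = 0) :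
    ((Finset.univ.filter fun b : ι → F =>
        (b - a) ⬝ᵥ (b - a) = 0 ∧ (b - a) ⬝ᵥ u = 0).card : ℝ) =
      (Fintype.card F : ℝ) ^ Fintype.card ι / Fintype.card F / Fintype.card F := by
  rw [card_filter_sub (fun b => b ⬝ᵥ b = 0 ∧ b ⬝ᵥ u = 0)]
  have h := card_isotropic_system (v := 0) hF he hι hu0 (by simp)
  have hq : (Fintype.card F : ℝ) ≠ 0 := by simp
  rw [sum_ite_smul_eq_zero hu] at h
  have h2 : (Fintype.card F : ℝ) ^ 3 *
      (Finset.univ.filter fun b : ι → F => b ⬝ᵥ b = 0 ∧ b ⬝ᵥ u = 0).card =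
        (Fintype.card F : ℝ) ^ Fintype.card ι * Fintype.card F := by
    simp only [dotProduct_zero, and_true] at h
    exact_mod_cast h
  field_simp
  refine mul_left_cancel₀ hq ?_
  linear_combination h2

open scoped Classical in
theorem card_isotropic_hyperplane_inter (hF : ringChar F ≠ 2) {e : AddChar F ℂ} (he : e ≠ 1)
    (hι : Odd (Fintype.card ι)) (a : ι → F) {u v : ι → F}
    (huv : ∀ s r : F, s • u + r • v = 0 → s = 0 ∧ r = 0) (hu0 : u ⬝ᵥ u = 0) (hv0 : v ⬝ᵥ v = 0) :
    ((Finset.univ.filter fun b : ι → F =>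
        (b - a) ⬝ᵥ (b - a) = 0 ∧ (b - a) ⬝ᵥ u = 0 ∧ (b - a) ⬝ᵥ v = 0).card : ℝ) =
      (Fintype.card F : ℝ) ^ Fintype.card ι / Fintype.card F / Fintype.card F ^ 2 := by
  rw [card_filter_sub (fun b => b ⬝ᵥ b = 0 ∧ b ⬝ᵥ u = 0 ∧ b ⬝ᵥ v = 0)]
  have h := card_isotropic_system hF he hι hu0 hv0
  have hq : (Fintype.card F : ℝ) ≠ 0 := by simp
  rw [sum_ite_smul_add_smul_eq_zero huv] at h
  have h2 : (Fintype.card F : ℝ) ^ 3 *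
      (Finset.univ.filter fun b : ι → F => b ⬝ᵥ b = 0 ∧ b ⬝ᵥ u = 0 ∧ b ⬝ᵥ v = 0).card =
        (Fintype.card F : ℝ) ^ Fintype.card ι * 1 := by
    exact_mod_cast h
  field_simp
  linear_combination h2

end Counting

section OrthogonalTriples

variable {F : Type*} [Field F] [Fintype F] {ι : Type*} [Fintype ι]

open scoped Classical in
/-- Incidences between points and the hyperplanes through `c` orthogonal to `a - c`, where
`a - c` is anisotropic. -/
theorem anisotropic_triples_le {e : AddChar F ℂ} (he : e ≠ 1) {k : ℕ}
    (hι : Fintype.card ι = 2 * k + 1) (E : Finset (ι → F)) (a : ι → F) :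
    ∑ c ∈ E.filter (fun c => (a - c) ⬝ᵥ (a - c) ≠ 0),
      ((E.filter fun b => (a - c) ⬝ᵥ (b - c) = 0).card : ℝ) ≤
      (E.card : ℝ) ^ 2 / Fintype.card F + (Fintype.card F : ℝ) ^ k * E.card := by
  have hq : (0 : ℝ) < Fintype.card F := by exact_mod_cast Fintype.card_pos
  have hU : ((Finset.univ : Finset (ι → F)).card : ℝ) =
      (Fintype.card F : ℝ) ^ Fintype.card ι := by
    simp
  have hR : ∀ b c : ι → F, (a - c) ⬝ᵥ (b - c) = 0 ↔ b ⬝ᵥ (a - c) = c ⬝ᵥ (a - c) := by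
    intro b c
    rw [dotProduct_comm, sub_dotProduct, sub_eq_zero]
  refine incidence_le (fun c b => (a - c) ⬝ᵥ (b - c) = 0) (fun c => {c}) _
    (Finset.subset_univ E) (k := 1) (by positivity) ?_ ?_ ?_ ?_ hq
    (by exact_mod_cast Finset.card_filter_le _ _) le_rfl
  · intro c hc
    have hc0 : a - c ≠ 0 := fun h0 => (Finset.mem_filter.mp hc).2 (by simp [h0])
    simp_rw [hR]
    rw [hU]
    exact card_hyperplane he hc0 _
  · intro c hc c' hc' hcc
    have hc := (Finset.mem_filter.mp hc).2
    have hc' := (Finset.mem_filter.mp hc').2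
    have hc0 : a - c ≠ 0 := fun h0 => hc (by simp [h0])
    simp_rw [hR]
    rw [hU]
    by_cases hind : ∀ s r : F, s • (a - c) + r • (a - c') = 0 → s = 0 ∧ r = 0
    · exact (card_hyperplane_inter he hind _ _).le
    · have hempty : (Finset.univ.filter fun b : ι → F =>
          b ⬝ᵥ (a - c) = c ⬝ᵥ (a - c) ∧ b ⬝ᵥ (a - c') = c' ⬝ᵥ (a - c')) = ∅ := by
        refine Finset.filter_eq_empty_iff.mpr fun b _ hb => hind fun s r hsr => ?_
        by_contra hne
        have hr : r ≠ 0 := by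
          rintro rfl
          apply hne
          simpa [hc0] using hsr
        obtain ⟨l, hl⟩ : ∃ l : F, a - c' = l • (a - c) := by
          refine ⟨-(s / r), ?_⟩
          have : r • (a - c') = r • (-(s / r)) • (a - c) := by
            rw [smul_smul, mul_neg, mul_div_cancel₀ _ hr, neg_smul]
            exact eq_neg_of_add_eq_zero_right hsr
          exact smul_right_injective _ hr this
        have hc'a : c' = a - l • (a - c) := by rw [← hl]; abel
        have hl0 : l ≠ 0 := by
          rintro rfl
          exact hc' (by simp [hl])
        have h1 : (b - a) ⬝ᵥ (a - c) = -((a - c) ⬝ᵥ (a - c)) := by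
          have : (b - c) ⬝ᵥ (a - c) = 0 := by rw [sub_dotProduct, hb.1, sub_self]
          rw [show b - a = (b - c) - (a - c) by abel, sub_dotProduct, this, zero_sub]
        have h2 : l * ((b - a) ⬝ᵥ (a - c)) = -(l * (l * ((a - c) ⬝ᵥ (a - c)))) := by
          have : (b - c') ⬝ᵥ (a - c') = 0 := by rw [sub_dotProduct, hb.2, sub_self]
          rw [show b - c' = (b - a) + (a - c') by abel, add_dotProduct, hl, smul_dotProduct,
            dotProduct_smul, dotProduct_smul, smul_eq_mul, smul_eq_mul, smul_eq_mul] at this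
          linear_combination this
        rw [h1] at h2
        have h3 : l * ((a - c) ⬝ᵥ (a - c)) * (l - 1) = 0 := by linear_combination h2
        have h4 : l = 1 := by
          rcases mul_eq_zero.mp h3 with h | h
          · exact absurd h (mul_ne_zero hl0 hc)
          · linear_combination h
        exact hcc (Finset.mem_singleton.mpr (by rw [hc'a, h4]; simp))
      rw [hempty]
      simp only [Finset.card_empty, Nat.cast_zero]
      positivity
  · intro c _
    simp
  · rw [hU, hι]
    field_simp
    ring_nf
    rfl

open scoped Classical in
/-- Pairs of orthogonal points on an isotropic cone with vertex `a`. -/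
theorem isotropic_triples_le (hF : ringChar F ≠ 2) {e : AddChar F ℂ} (he : e ≠ 1) {k : ℕ}
    (hι : Fintype.card ι = 2 * k + 1) (E : Finset (ι → F)) (a : ι → F) :
    ∑ c ∈ E.filter (fun c => c - a ≠ 0 ∧ (c - a) ⬝ᵥ (c - a) = 0),
      (((E.filter fun b => (b - a) ⬝ᵥ (b - a) = 0).filter
        fun b => (b - a) ⬝ᵥ (c - a) = 0).card : ℝ) ≤
      (E.card : ℝ) ^ 2 / Fintype.card F + (Fintype.card F : ℝ) ^ k * E.card := by
  have hq : (0 : ℝ) < Fintype.card F := by exact_mod_cast Fintype.card_pos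
  have hodd : Odd (Fintype.card ι) := ⟨k, hι⟩
  have hU := card_isotropic hF he hodd a
  refine incidence_le (fun c b => (b - a) ⬝ᵥ (c - a) = 0)
    (fun c => Finset.univ.image fun l : F => l • (c - a) + a) _
    (U := Finset.univ.filter fun b => (b - a) ⬝ᵥ (b - a) = 0)
    (Finset.filter_subset_filter _ (Finset.subset_univ E)) (k := Fintype.card F)
    (by positivity) ?_ ?_ ?_ ?_ hq
    (by exact_mod_cast Finset.card_filter_le _ _) (by exact_mod_cast Finset.card_filter_le _ _)
  · intro c hc
    obtain ⟨hc0, hc1⟩ := (Finset.mem_filter.mp hc).2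
    rw [hU, Finset.filter_filter]
    exact card_isotropic_hyperplane hF he hodd a hc0 hc1
  · intro c hc c' hc' hcc
    obtain ⟨hc0, hc1⟩ := (Finset.mem_filter.mp hc).2
    obtain ⟨hc0', hc1'⟩ := (Finset.mem_filter.mp hc').2
    rw [hU, Finset.filter_filter]
    refine (card_isotropic_hyperplane_inter hF he hodd a (fun s r hsr => ?_) hc1 hc1').le
    by_contra hne
    have hr : r ≠ 0 := by
      rintro rfl
      apply hne
      simpa [hc0] using hsr
    refine hcc (Finset.mem_image.mpr ⟨-(s / r), Finset.mem_univ _, ?_⟩)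
    rw [eq_comm, ← sub_eq_iff_eq_add]
    have : r • (c' - a) = r • (-(s / r)) • (c - a) := by
      rw [smul_smul, mul_neg, mul_div_cancel₀ _ hr, neg_smul]
      exact eq_neg_of_add_eq_zero_right hsr
    exact smul_right_injective _ hr this
  · intro c _
    exact_mod_cast Finset.card_image_le
  · rw [hU, hι]
    field_simp
    ring_nf
    rfl

open scoped Classical in
/-- The number of triples `(a, c, b) ∈ E ^ 3` with a right angle at `c`. -/
noncomputable def rightAngles (E : Finset (ι → F)) : ℝ :=
  ∑ a ∈ E, ∑ c ∈ E, ∑ b ∈ E, if (a - c) ⬝ᵥ (b - c) = 0 then 1 else 0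

theorem rightAngles_le (hF : ringChar F ≠ 2) {e : AddChar F ℂ} (he : e ≠ 1) {k : ℕ}
    (hι : Fintype.card ι = 2 * k + 1) (E : Finset (ι → F)) :
    rightAngles E ≤ 3 * ((E.card : ℝ) ^ 3 / Fintype.card F) +
      4 * ((Fintype.card F : ℝ) ^ k * (E.card : ℝ) ^ 2) := by
  classical
  set D : ℝ := (E.card : ℝ) ^ 2 / Fintype.card F + (Fintype.card F : ℝ) ^ k * E.card with hD
  let X : (ι → F) → (ι → F) → (ι → F) → ℝ := fun a c b =>
    if (a - c) ⬝ᵥ (a - c) ≠ 0 then if (a - c) ⬝ᵥ (b - c) = 0 then 1 else 0 else 0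
  let Y : (ι → F) → (ι → F) → (ι → F) → ℝ := fun a c b =>
    if c - a ≠ 0 ∧ (c - a) ⬝ᵥ (c - a) = 0 then
      if (b - a) ⬝ᵥ (b - a) = 0 then if (b - a) ⬝ᵥ (c - a) = 0 then 1 else 0 else 0 else 0
  have hX : ∀ a, ∑ c ∈ E, ∑ b ∈ E, X a c b ≤ D := by
    intro a
    refine le_trans (le_of_eq ?_) (anisotropic_triples_le he hι E a)
    rw [Finset.sum_filter]
    refine Finset.sum_congr rfl fun c _ => ?_
    simp only [X]
    split_ifs <;> simp
  have hY : ∀ a, ∑ c ∈ E, ∑ b ∈ E, Y a c b ≤ D := by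
    intro a
    refine le_trans (le_of_eq ?_) (isotropic_triples_le hF he hι E a)
    rw [Finset.sum_filter]
    refine Finset.sum_congr rfl fun c _ => ?_
    simp only [Y]
    split_ifs
    · rw [Finset.card_filter, Finset.sum_filter]
      push_cast
      rfl
    · simp
  have hswap : ∑ a ∈ E, ∑ c ∈ E, ∑ b ∈ E, X b c a = ∑ a ∈ E, ∑ c ∈ E, ∑ b ∈ E, X a c b := by
    rw [Finset.sum_comm]
    conv_rhs => rw [Finset.sum_comm]
    exact Finset.sum_congr rfl fun c _ => Finset.sum_comm
  have hpt : ∀ a c b : ι → F, (if (a - c) ⬝ᵥ (b - c) = 0 then 1 else 0 : ℝ) ≤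
      (if c = a then 1 else 0) + X a c b + X b c a + Y a c b := by
    intro a c b
    have hX0 : ∀ a c b, 0 ≤ X a c b := fun a c b => by
      simp only [X]; split_ifs <;> norm_num
    have hY0 : 0 ≤ Y a c b := by
      simp only [Y]; split_ifs <;> norm_num
    have h1 := hX0 a c b
    have h2 := hX0 b c a
    have h0 : (0 : ℝ) ≤ if c = a then 1 else 0 := by split_ifs <;> norm_num
    split_ifs with h hca
    · linarith
    · by_cases hac : (a - c) ⬝ᵥ (a - c) = 0
      · by_cases hbc : (b - c) ⬝ᵥ (b - c) = 0
        · have e1 : b - a = (b - c) - (a - c) := by abel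
          have e2 : c - a = -(a - c) := by abel
          have hba : (b - a) ⬝ᵥ (b - a) = 0 := by
            rw [e1]
            simp only [sub_dotProduct (b - c), dotProduct_sub _ (b - c) (a - c), hac, hbc, h,
              dotProduct_comm (b - c) (a - c)]
            simp
          have hbca : (b - a) ⬝ᵥ (c - a) = 0 := by
            rw [e1, e2, dotProduct_neg, sub_dotProduct (b - c), hac, dotProduct_comm, h]
            simp
          have hY1 : Y a c b = 1 := by
            simp only [Y]
            rw [if_pos ⟨sub_ne_zero.mpr hca, by rw [e2, neg_dotProduct_neg, hac]⟩, if_pos hba, if_pos hbca]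
          linarith
        · have : X b c a = 1 := by
            simp only [X]
            rw [if_pos hbc, if_pos (by rw [dotProduct_comm, h])]
          linarith
      · have : X a c b = 1 := by
          simp only [X]
          rw [if_pos hac, if_pos h]
        linarith
    · linarith
    · linarith
  have hdiag : ∑ a ∈ E, ∑ c ∈ E, ∑ _b ∈ E, (if c = a then 1 else 0 : ℝ) = (E.card : ℝ) ^ 2 := by
    simp [sq]
  have hconst : ∀ Z : (ι → F) → (ι → F) → (ι → F) → ℝ,
      (∀ a, ∑ c ∈ E, ∑ b ∈ E, Z a c b ≤ D) →
      ∑ a ∈ E, ∑ c ∈ E, ∑ b ∈ E, Z a c b ≤ E.card * D := fun Z hZ => by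
    rw [← nsmul_eq_mul]
    exact Finset.sum_le_card_nsmul _ _ _ fun a _ => hZ a
  have hone : (1 : ℝ) ≤ (Fintype.card F : ℝ) ^ k :=
    one_le_pow₀ (by exact_mod_cast Fintype.card_pos)
  have hbound : rightAngles E ≤ (E.card : ℝ) ^ 2 + E.card * D + E.card * D + E.card * D := by
    calc rightAngles E ≤ ∑ a ∈ E, ∑ c ∈ E, ∑ b ∈ E,
          ((if c = a then 1 else 0) + X a c b + X b c a + Y a c b) :=
          Finset.sum_le_sum fun a _ => Finset.sum_le_sum fun c _ => Finset.sum_le_sum fun b _ => by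
            convert hpt a c b
      _ ≤ _ := by
          simp only [Finset.sum_add_distrib]
          rw [hswap, hdiag]
          gcongr
          · exact hconst X hX
          · exact hconst X hX
          · exact hconst Y hY
  have hED : E.card * D = (E.card : ℝ) ^ 3 / Fintype.card F +
      (Fintype.card F : ℝ) ^ k * (E.card : ℝ) ^ 2 := by
    rw [hD]; ring
  have hEE : (E.card : ℝ) ^ 2 ≤ (Fintype.card F : ℝ) ^ k * (E.card : ℝ) ^ 2 :=
    le_mul_of_one_le_left (by positivity) hone
  linarith

end OrthogonalTriples

section ExtensionEstimate

variable {F : Type*} [Field F] [Fintype F] {ι : Type*} [Fintype ι] [DecidableEq ι]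

open scoped Classical in
theorem sum_norm_sq_le {e : AddChar F ℂ} (he : e ≠ 1) {J : Type*} (s : Finset J) (w : J → ℂ)
    (φ : J → ι → F) (ψ : J → F) :
    ∑ ξ : ι → F, ∑ τ : F, ‖∑ j ∈ s, w j * e (ξ ⬝ᵥ φ j + τ * ψ j)‖ ^ 2 ≤
      (Fintype.card F : ℝ) ^ (Fintype.card ι + 1) *
        ∑ j ∈ s, ∑ k ∈ s, if φ j = φ k ∧ ψ j = ψ k then ‖w j‖ * ‖w k‖ else 0 := by
  have hp := AddChar.IsPrimitive.of_ne_one he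
  have hexp : ((∑ ξ : ι → F, ∑ τ : F, ‖∑ j ∈ s, w j * e (ξ ⬝ᵥ φ j + τ * ψ j)‖ ^ 2 : ℝ) : ℂ) =
      ∑ j ∈ s, ∑ k ∈ s, (w j * starRingEnd ℂ (w k)) *
        ((∑ ξ : ι → F, e (ξ ⬝ᵥ (φ j - φ k))) * ∑ τ : F, e (τ * (ψ j - ψ k))) := by
    push_cast
    have h1 : ∀ ξ : ι → F, ∀ τ : F,
        ((‖∑ j ∈ s, w j * e (ξ ⬝ᵥ φ j + τ * ψ j)‖ : ℝ) : ℂ) ^ 2 =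
        ∑ j ∈ s, ∑ k ∈ s, (w j * starRingEnd ℂ (w k)) *
          (e (ξ ⬝ᵥ (φ j - φ k)) * e (τ * (ψ j - ψ k))) := by
      intro ξ τ
      rw [← Complex.mul_conj', map_sum, Finset.sum_mul_sum]
      refine Finset.sum_congr rfl fun j _ => Finset.sum_congr rfl fun k _ => ?_
      rw [map_mul, ← AddChar.map_neg_eq_conj, mul_mul_mul_comm, ← AddChar.map_add_eq_mul,
        ← AddChar.map_add_eq_mul, dotProduct_sub]
      congr 2
      ring
    simp_rw [h1]
    rw [Finset.sum_congr rfl fun ξ _ => Finset.sum_comm, Finset.sum_comm]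
    refine Finset.sum_congr rfl fun j _ => ?_
    rw [Finset.sum_congr rfl fun ξ _ => Finset.sum_comm, Finset.sum_comm]
    refine Finset.sum_congr rfl fun k _ => ?_
    rw [Finset.sum_mul_sum, Finset.mul_sum]
    exact Finset.sum_congr rfl fun ξ _ => by rw [Finset.mul_sum]
  have hnonneg : 0 ≤ ∑ ξ : ι → F, ∑ τ : F, ‖∑ j ∈ s, w j * e (ξ ⬝ᵥ φ j + τ * ψ j)‖ ^ 2 := by
    positivity
  rw [← Real.norm_of_nonneg hnonneg, ← Complex.norm_real, hexp, Finset.mul_sum]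
  refine (norm_sum_le _ _).trans (Finset.sum_le_sum fun j _ => ?_)
  rw [Finset.mul_sum]
  refine (norm_sum_le _ _).trans (Finset.sum_le_sum fun k _ => ?_)
  rw [sum_addChar_dotProduct he, AddChar.sum_mulShift _ hp]
  by_cases h1 : φ j = φ k <;> by_cases h2 : ψ j = ψ k <;>
    simp [h1, h2, sub_eq_zero]
  exact le_of_eq (by ring)

/-- The `L⁴` extension estimate for the paraboloid. -/
theorem sum_norm_pow_four_le {e : AddChar F ℂ} (he : e ≠ 1) (hF : ringChar F ≠ 2)
    (E : Finset (ι → F)) (h : (ι → F) → ℂ) {M : ℝ} (hM : ∀ x ∈ E, ‖h x‖ ≤ M) :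
    ∑ ξ : ι → F, ∑ τ : F, ‖∑ x ∈ E, h x * e (ξ ⬝ᵥ x + τ * (x ⬝ᵥ x))‖ ^ 4 ≤
      (Fintype.card F : ℝ) ^ (Fintype.card ι + 1) * (M ^ 4 * rightAngles E) := by
  classical
  have hsq : ∀ ξ : ι → F, ∀ τ : F, ‖∑ x ∈ E, h x * e (ξ ⬝ᵥ x + τ * (x ⬝ᵥ x))‖ ^ 4 =
      ‖∑ j ∈ E ×ˢ E, (h j.1 * h j.2) *
        e (ξ ⬝ᵥ (j.1 + j.2) + τ * (j.1 ⬝ᵥ j.1 + j.2 ⬝ᵥ j.2))‖ ^ 2 := by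
    intro ξ τ
    rw [show 4 = 2 * 2 from rfl, pow_mul, ← norm_pow _ 2, sq (∑ x ∈ E, _), Finset.sum_mul_sum,
      Finset.sum_product]
    congr 2
    refine Finset.sum_congr rfl fun a _ => Finset.sum_congr rfl fun b _ => ?_
    rw [mul_mul_mul_comm, ← AddChar.map_add_eq_mul, dotProduct_add]
    congr 2
    ring
  simp_rw [hsq]
  refine (sum_norm_sq_le he (E ×ˢ E) _ _ _).trans ?_
  gcongr
  rw [Finset.sum_product, rightAngles, Finset.mul_sum]
  refine Finset.sum_le_sum fun a ha => ?_
  rw [Finset.sum_congr rfl fun b _ => Finset.sum_product _ _ _, Finset.sum_comm, Finset.mul_sum]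
  refine Finset.sum_le_sum fun c hc => ?_
  rw [Finset.mul_sum]
  refine Finset.sum_le_sum fun b hb => ?_
  have hM0 : 0 ≤ M := (norm_nonneg _).trans (hM a ha)
  have h2 : (2 : F) ≠ 0 := Ring.two_ne_zero hF
  calc ∑ x ∈ E, (if a + b = c + x ∧ a ⬝ᵥ a + b ⬝ᵥ b = c ⬝ᵥ c + x ⬝ᵥ x
          then ‖h a * h b‖ * ‖h c * h x‖ else 0)
      ≤ ∑ x ∈ E, if x = a + b - c then
          M ^ 4 * (if (a - c) ⬝ᵥ (b - c) = 0 then 1 else 0) else 0 := by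
        refine Finset.sum_le_sum fun x hx => ?_
        split_ifs with h1 h3 h4 h5 h6
        · rw [norm_mul, norm_mul, mul_one, show M ^ 4 = M * M * (M * M) by ring]
          gcongr <;> apply hM <;> assumption
        · exfalso
          apply h4
          have e1 := h1.2
          rw [h3] at e1
          simp only [sub_dotProduct, add_dotProduct, dotProduct_sub, dotProduct_add,
            dotProduct_comm b a, dotProduct_comm c a, dotProduct_comm c b] at e1 ⊢
          refine mul_left_cancel₀ h2 ?_
          linear_combination -e1
        · exact absurd (by rw [h1.1]; abel) h3
        · positivity
        · simp
        · rfl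
    _ ≤ M ^ 4 * (if (a - c) ⬝ᵥ (b - c) = 0 then 1 else 0) := by
        rw [Finset.sum_ite_eq']
        split_ifs
        all_goals first | exact le_rfl | positivity
    _ ≤ _ := le_of_eq (by congr)

end ExtensionEstimate

theorem sum_rpow_le {J : Type*} (s : Finset J) (a : J → ℝ) (ha : ∀ j ∈ s, 0 ≤ a j) {θ : ℝ}
    (hθ : 0 < θ) (hθ1 : θ ≤ 1) :
    ∑ j ∈ s, a j ^ θ ≤ (s.card : ℝ) ^ (1 - θ) * (∑ j ∈ s, a j) ^ θ := by
  have h := Real.rpow_sum_le_const_mul_sum_rpow_of_nonneg s (f := fun j => a j ^ θ) (p := θ⁻¹)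
    (one_le_inv_iff₀.mpr ⟨hθ, hθ1⟩) (fun j hj => Real.rpow_nonneg (ha j hj) _)
  have h1 : ∑ j ∈ s, (a j ^ θ) ^ θ⁻¹ = ∑ j ∈ s, a j :=
    Finset.sum_congr rfl fun j hj => by
      rw [← Real.rpow_mul (ha j hj), mul_inv_cancel₀ hθ.ne', Real.rpow_one]
  rw [h1] at h
  have hnn : 0 ≤ ∑ j ∈ s, a j ^ θ := Finset.sum_nonneg fun j hj => Real.rpow_nonneg (ha j hj) _
  have h2 := Real.rpow_le_rpow (by positivity) h hθ.le
  rw [← Real.rpow_mul hnn, inv_mul_cancel₀ hθ.ne', Real.rpow_one,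
    Real.mul_rpow (by positivity) (Finset.sum_nonneg ha), ← Real.rpow_mul (by positivity)] at h2
  convert h2 using 3
  field_simp

open scoped Classical in
/-- The slice `{x : (x, t) ∈ G}`. -/
noncomputable def timeSlice {F ι : Type*} [Fintype F] [Fintype ι] (G : Finset ((ι → F) × F))
    (t : F) : Finset (ι → F) :=
  Finset.univ.filter fun z => (z, t) ∈ G

theorem sum_card_timeSlice {F ι : Type*} [Fintype F] [Fintype ι]
    (G : Finset ((ι → F) × F)) :
    ∑ t : F, ((timeSlice G t).card : ℝ) = G.card := by
  classical
  have : G.card = ∑ t : F, (timeSlice G t).card := by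
    have h1 : ∀ t, (timeSlice G t).card = ∑ z : ι → F, if (z, t) ∈ G then 1 else 0 := fun t => by
      rw [timeSlice, Finset.card_filter]
    simp_rw [h1]
    rw [← Fintype.sum_prod_type_right (fun p => if p ∈ G then 1 else 0)]
    simp
  exact_mod_cast this.symm

section Restriction

variable {F : Type*} [Field F] [Fintype F] {ι : Type*} [Fintype ι] [DecidableEq ι]

/-- The pairing of a point mass at `x` with the slice of `g` at height `t`, through the Fourier
transform of the paraboloid, is an extension operator applied to that slice. -/
theorem norm_sum_mul_sum_addChar (hF : ringChar F ≠ 2) {e : AddChar F ℂ} (he : e ≠ 1)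
    (h : (ι → F) → ℂ) (x : ι → F) {s : F} (hs : s ≠ 0) :
    ‖∑ z : ι → F, h z * ∑ y : ι → F, e (s * (y ⬝ᵥ y) + y ⬝ᵥ (z - x))‖ =
      Real.sqrt (Fintype.card F) ^ Fintype.card ι *
        ‖∑ z : ι → F, h z * e (((2 * s)⁻¹ • x) ⬝ᵥ z + -(4 * s)⁻¹ * (z ⬝ᵥ z))‖ := by
  classical
  have h2 : (2 : F) ≠ 0 := Ring.two_ne_zero hF
  have h4 : (4 : F) ≠ 0 := by
    have : (4 : F) = 2 * 2 := by norm_num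
    rw [this]; exact mul_ne_zero h2 h2
  have key : ∀ z : ι → F, h z * ∑ y : ι → F, e (s * (y ⬝ᵥ y) + y ⬝ᵥ (z - x)) =
      (((quadraticChar F s : ℂ) * quadGauss e) ^ Fintype.card ι * e (-(x ⬝ᵥ x) / (4 * s))) *
        (h z * e (((2 * s)⁻¹ • x) ⬝ᵥ z + -(4 * s)⁻¹ * (z ⬝ᵥ z))) := by
    intro z
    rw [sum_addChar_quadratic hF he hs, mul_assoc, mul_left_comm]
    congr 1
    rw [mul_left_comm, ← AddChar.map_add_eq_mul]
    congr 2
    simp only [sub_dotProduct, dotProduct_sub, smul_dotProduct, smul_eq_mul,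
      dotProduct_comm z x]
    field_simp
    ring
  simp_rw [key]
  rw [← Finset.mul_sum, norm_mul, norm_mul, norm_pow, norm_mul, AddChar.norm_apply, mul_one]
  congr 2
  have hg : ‖quadGauss e‖ = Real.sqrt (Fintype.card F) := by
    rw [← norm_quadGauss_sq hF he, Real.sqrt_sq (norm_nonneg _)]
  rw [hg]
  rcases quadraticChar_dichotomy (F := F) hs with h | h <;> simp [h]

theorem norm_sum_mul_sum_addChar_zero {e : AddChar F ℂ} (he : e ≠ 1)
    (h : (ι → F) → ℂ) (x : ι → F) :
    ‖∑ z : ι → F, h z * ∑ y : ι → F, e (0 * (y ⬝ᵥ y) + y ⬝ᵥ (z - x))‖ =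
      (Fintype.card F : ℝ) ^ Fintype.card ι * ‖h x‖ := by
  classical
  simp_rw [zero_mul, zero_add, sum_addChar_dotProduct he, sub_eq_zero]
  simp [mul_comm]

open scoped Classical in
/-- Splitting `‖ĝ‖²` over the paraboloid according to the slices `{x_d = t}`. -/
theorem sum_norm_sq_paraboloid_le (hF : ringChar F ≠ 2) {e : AddChar F ℂ} (he : e ≠ 1)
    (g : (ι → F) × F → ℂ) (G : Finset ((ι → F) × F)) (hG : ∀ x, x ∉ G → g x = 0)
    (hg : ∀ x ∈ G, ‖g x‖ ≤ 2) :
    ∑ y : ι → F, ‖∑ x : (ι → F) × F, g x * e (-(x.1 ⬝ᵥ y + x.2 * (y ⬝ᵥ y)))‖ ^ 2 ≤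
      4 * (Fintype.card F : ℝ) ^ Fintype.card ι * G.card +
        2 * Real.sqrt (Fintype.card F) ^ Fintype.card ι * ∑ t : F,
          ∑ x ∈ G.filter (fun x => x.2 ≠ t), ‖∑ z : ι → F, starRingEnd ℂ (g (z, t)) *
            e (((2 * (t - x.2))⁻¹ • x.1) ⬝ᵥ z + -(4 * (t - x.2))⁻¹ * (z ⬝ᵥ z))‖ := by
  set S : F → (ι → F) × F → ℂ := fun t x => ∑ z : ι → F, starRingEnd ℂ (g (z, t)) *
    ∑ y : ι → F, e ((t - x.2) * (y ⬝ᵥ y) + y ⬝ᵥ (z - x.1)) with hS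
  have hexp : ((∑ y : ι → F, ‖∑ x : (ι → F) × F,
      g x * e (-(x.1 ⬝ᵥ y + x.2 * (y ⬝ᵥ y)))‖ ^ 2 : ℝ) : ℂ) =
      ∑ x ∈ G, ∑ t : F, g x * S t x := by
    push_cast
    have h1 : ∀ y : ι → F, ((‖∑ x : (ι → F) × F,
        g x * e (-(x.1 ⬝ᵥ y + x.2 * (y ⬝ᵥ y)))‖ : ℝ) : ℂ) ^ 2 =
        ∑ x ∈ G, ∑ t : F, ∑ z : ι → F, g x * (starRingEnd ℂ (g (z, t)) *
          e ((t - x.2) * (y ⬝ᵥ y) + y ⬝ᵥ (z - x.1))) := by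
      intro y
      have hsub : ∑ x : (ι → F) × F, g x * e (-(x.1 ⬝ᵥ y + x.2 * (y ⬝ᵥ y))) =
          ∑ x ∈ G, g x * e (-(x.1 ⬝ᵥ y + x.2 * (y ⬝ᵥ y))) :=
        (Finset.sum_subset (Finset.subset_univ G) fun x _ hx => by rw [hG x hx, zero_mul]).symm
      rw [← Complex.mul_conj']
      nth_rw 1 [hsub]
      rw [map_sum, Finset.sum_mul]
      refine Finset.sum_congr rfl fun x _ => ?_
      rw [Fintype.sum_prod_type_right, Finset.mul_sum]
      refine Finset.sum_congr rfl fun t _ => ?_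
      rw [Finset.mul_sum]
      refine Finset.sum_congr rfl fun z _ => ?_
      rw [map_mul, ← AddChar.map_neg_eq_conj, mul_mul_mul_comm, ← AddChar.map_add_eq_mul,
        mul_assoc, dotProduct_sub, dotProduct_comm y z, dotProduct_comm y x.1]
      congr 3
      ring
    simp_rw [h1]
    rw [Finset.sum_comm]
    refine Finset.sum_congr rfl fun x _ => ?_
    rw [Finset.sum_comm]
    refine Finset.sum_congr rfl fun t _ => ?_
    rw [Finset.sum_comm, hS, Finset.mul_sum]
    refine Finset.sum_congr rfl fun z _ => ?_
    rw [← Finset.mul_sum, ← Finset.mul_sum]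
  have hterm : ∀ x ∈ G, ∀ t : F, ‖g x * S t x‖ ≤
      (if t = x.2 then 4 * (Fintype.card F : ℝ) ^ Fintype.card ι else 0) +
      (if x.2 ≠ t then 2 * Real.sqrt (Fintype.card F) ^ Fintype.card ι *
        ‖∑ z : ι → F, starRingEnd ℂ (g (z, t)) *
          e (((2 * (t - x.2))⁻¹ • x.1) ⬝ᵥ z + -(4 * (t - x.2))⁻¹ * (z ⬝ᵥ z))‖ else 0) := by
    intro x hx t
    have hgx := hg x hx
    rw [norm_mul]
    by_cases ht : t = x.2
    · subst ht
      simp only [hS, sub_self, if_true, ne_eq, not_true_eq_false, if_false, add_zero]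
      rw [norm_sum_mul_sum_addChar_zero he, RCLike.norm_conj, Prod.mk.eta]
      calc ‖g x‖ * ((Fintype.card F : ℝ) ^ Fintype.card ι * ‖g x‖)
          ≤ 2 * ((Fintype.card F : ℝ) ^ Fintype.card ι * 2) := by gcongr
        _ = _ := by ring
    · rw [if_neg ht, if_pos (Ne.symm ht), zero_add, hS,
        norm_sum_mul_sum_addChar hF he _ _ (sub_ne_zero.mpr ht), mul_assoc]
      gcongr
  have hnonneg : 0 ≤ ∑ y : ι → F, ‖∑ x : (ι → F) × F,
      g x * e (-(x.1 ⬝ᵥ y + x.2 * (y ⬝ᵥ y)))‖ ^ 2 := by positivity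
  rw [← Real.norm_of_nonneg hnonneg, ← Complex.norm_real, hexp]
  calc ‖∑ x ∈ G, ∑ t : F, g x * S t x‖
      ≤ ∑ x ∈ G, ∑ t : F, ‖g x * S t x‖ :=
        (norm_sum_le _ _).trans (Finset.sum_le_sum fun x _ => norm_sum_le _ _)
    _ ≤ _ := Finset.sum_le_sum fun x hx => Finset.sum_le_sum fun t _ => hterm x hx t
    _ = _ := by
        simp only [Finset.sum_add_distrib]
        congr 1
        · simp only [Finset.sum_ite_eq', Finset.mem_univ, if_true, Finset.sum_const, nsmul_eq_mul]
          ring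
        · rw [Finset.sum_comm, Finset.mul_sum]
          refine Finset.sum_congr rfl fun t _ => ?_
          rw [Finset.mul_sum, Finset.sum_filter]

open scoped Classical in
/-- Hölder's inequality and the `L⁴` extension estimate for a single slice. -/
theorem sum_norm_timeSlice_pow_four_le (hF : ringChar F ≠ 2) {e : AddChar F ℂ} (he : e ≠ 1)
    (g : (ι → F) × F → ℂ) (G : Finset ((ι → F) × F)) (hG : ∀ x, x ∉ G → g x = 0)
    (hg : ∀ x ∈ G, ‖g x‖ ≤ 2) (t : F) :
    (∑ x ∈ G.filter (fun x => x.2 ≠ t), ‖∑ z : ι → F, starRingEnd ℂ (g (z, t)) *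
        e (((2 * (t - x.2))⁻¹ • x.1) ⬝ᵥ z + -(4 * (t - x.2))⁻¹ * (z ⬝ᵥ z))‖) ^ 4 ≤
      (G.card : ℝ) ^ 3 * ((Fintype.card F : ℝ) ^ (Fintype.card ι + 1) *
        (2 ^ 4 * rightAngles (timeSlice G t))) := by
  have h2 : (2 : F) ≠ 0 := Ring.two_ne_zero hF
  have h4 : (4 : F) ≠ 0 := by
    have : (4 : F) = 2 * 2 := by norm_num
    rw [this]; exact mul_ne_zero h2 h2
  set H : (ι → F) × F → ℝ := fun p => ‖∑ z ∈ timeSlice G t, starRingEnd ℂ (g (z, t)) *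
    e (p.1 ⬝ᵥ z + p.2 * (z ⬝ᵥ z))‖ with hH
  set Φ : (ι → F) × F → (ι → F) × F :=
    fun x => ((2 * (t - x.2))⁻¹ • x.1, -(4 * (t - x.2))⁻¹) with hΦ
  have hHΦ : ∀ x : (ι → F) × F, ‖∑ z : ι → F, starRingEnd ℂ (g (z, t)) *
      e (((2 * (t - x.2))⁻¹ • x.1) ⬝ᵥ z + -(4 * (t - x.2))⁻¹ * (z ⬝ᵥ z))‖ = H (Φ x) := by
    intro x
    simp only [hH, hΦ]
    congr 1
    refine (Finset.sum_subset (Finset.subset_univ _) fun z _ hz => ?_).symm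
    rw [hG (z, t) (by simpa [timeSlice] using hz)]
    simp
  simp_rw [hHΦ]
  set A := G.filter (fun x => x.2 ≠ t) with hA
  have hinj : Set.InjOn Φ A := by
    intro x hx y hy hxy
    have hx0 : t - x.2 ≠ 0 := sub_ne_zero.mpr (Finset.mem_filter.mp hx).2.symm
    have hxy2 : x.2 = y.2 := by
      have := neg_injective (congrArg Prod.snd hxy)
      have := mul_left_cancel₀ h4 (inv_injective this)
      linear_combination -this
    refine Prod.ext ?_ hxy2
    have := congrArg Prod.fst hxy
    simp only [hΦ, ← hxy2] at this
    exact smul_right_injective _ (inv_ne_zero (mul_ne_zero h2 hx0)) this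
  have hHnn : ∀ p, 0 ≤ H p := fun p => norm_nonneg _
  calc (∑ x ∈ A, H (Φ x)) ^ 4 ≤ (A.card : ℝ) ^ 3 * ∑ x ∈ A, H (Φ x) ^ 4 :=
        pow_sum_le_card_mul_sum_pow (fun _ _ => hHnn _) 3
    _ ≤ (G.card : ℝ) ^ 3 * ∑ p, H p ^ 4 := by
        gcongr
        · exact Finset.filter_subset _ _
        · rw [← Finset.sum_image (f := fun p => H p ^ 4) hinj]
          exact Finset.sum_le_sum_of_subset_of_nonneg (Finset.subset_univ _)
            fun _ _ _ => by positivity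
    _ ≤ _ := by
        gcongr
        rw [Fintype.sum_prod_type]
        refine sum_norm_pow_four_le he hF (timeSlice G t) (fun z => starRingEnd ℂ (g (z, t)))
          fun z hz => ?_
        rw [RCLike.norm_conj]
        exact hg _ (by simpa [timeSlice] using hz)

end Restriction

theorem le_rpow_add_rpow_of_pow_four_le {J N m q : ℝ} {k : ℕ} (hN : 0 ≤ N)
    (hm : 0 ≤ m) (hq : 0 < q)
    (h : J ^ 4 ≤ N ^ 3 * (q ^ (2 * k + 1 + 1) *
      (2 ^ 4 * (3 * (m ^ 3 / q) + 4 * (q ^ k * m ^ 2))))) :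
    J ≤ 3 * N ^ (3 / 4 : ℝ) * (q ^ ((2 * k + 1 : ℝ) / 4) * m ^ (3 / 4 : ℝ) +
      q ^ ((3 * k + 2 : ℝ) / 4) * m ^ (1 / 2 : ℝ)) := by
  set u := q ^ ((2 * k + 1 : ℝ) / 4) * m ^ (3 / 4 : ℝ) with hu
  set v := q ^ ((3 * k + 2 : ℝ) / 4) * m ^ (1 / 2 : ℝ) with hv
  have hu0 : 0 ≤ u := by positivity
  have hv0 : 0 ≤ v := by positivity
  have pow4 : ∀ {x : ℝ} (_ : 0 ≤ x) (s : ℝ) (n : ℕ), s * 4 = n → (x ^ s) ^ 4 = x ^ n := by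
    intro x hx s n hs
    rw [← Real.rpow_natCast (x ^ s) 4, ← Real.rpow_mul hx]
    push_cast
    rw [hs, Real.rpow_natCast]
  have hN4 : (N ^ (3 / 4 : ℝ)) ^ 4 = N ^ 3 := pow4 hN _ 3 (by norm_num)
  have hu4 : u ^ 4 = q ^ (2 * k + 1) * m ^ 3 := by
    rw [hu, mul_pow, pow4 hq.le _ (2 * k + 1) (by push_cast; ring), pow4 hm _ 3 (by norm_num)]
  have hv4 : v ^ 4 = q ^ (3 * k + 2) * m ^ 2 := by
    rw [hv, mul_pow, pow4 hq.le _ (3 * k + 2) (by push_cast; ring), pow4 hm _ 2 (by norm_num)]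
  refine le_of_pow_le_pow_left₀ (n := 4) (by norm_num) (by positivity) (h.trans ?_)
  have e1 : q ^ (2 * k + 1 + 1) * (2 ^ 4 * (3 * (m ^ 3 / q) + 4 * (q ^ k * m ^ 2))) =
      48 * u ^ 4 + 64 * v ^ 4 := by
    rw [hu4, hv4]
    field_simp
    ring
  have e3 : (3 * N ^ (3 / 4 : ℝ) * (u + v)) ^ 4 = N ^ 3 * (81 * (u + v) ^ 4) := by
    rw [mul_pow, mul_pow, hN4]
    ring
  rw [e1, e3]
  refine mul_le_mul_of_nonneg_left ?_ (by positivity)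
  have e2 : u ^ 4 + v ^ 4 ≤ (u + v) ^ 4 := pow_add_pow_le hu0 hv0 (by norm_num)
  have : 0 ≤ u ^ 4 := by positivity
  have : 0 ≤ v ^ 4 := by positivity
  linarith

/-- The square of the restriction estimate, before normalization. -/
theorem sum_norm_sq_paraboloid_le_card {F : Type*} [Field F] [Fintype F] {ι : Type*} [Fintype ι]
    [DecidableEq ι] (hF : ringChar F ≠ 2) {e : AddChar F ℂ} (he : e ≠ 1) {k : ℕ}
    (hι : Fintype.card ι = 2 * k + 1) (g : (ι → F) × F → ℂ) (G : Finset ((ι → F) × F))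
    (hG : ∀ x, x ∉ G → g x = 0) (hg : ∀ x ∈ G, ‖g x‖ ≤ 2) :
    ((Fintype.card F : ℝ) ^ (2 * k + 1))⁻¹ *
      ∑ y : ι → F, ‖∑ x : (ι → F) × F, g x * e (-(x.1 ⬝ᵥ y + x.2 * (y ⬝ᵥ y)))‖ ^ 2 ≤
      4 * G.card + 6 * ((G.card : ℝ) ^ (3 / 2 : ℝ) * (Fintype.card F : ℝ) ^ (-(k : ℝ) / 2)) +
        6 * ((Fintype.card F : ℝ) ^ ((2 - (k : ℝ)) / 4) * (G.card : ℝ) ^ (5 / 4 : ℝ)) := by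
  classical
  set q : ℝ := (Fintype.card F : ℝ) with hq_def
  set N : ℝ := (G.card : ℝ) with hN_def
  have hq : 0 < q := by rw [hq_def]; exact_mod_cast Fintype.card_pos
  have hN : 0 ≤ N := Nat.cast_nonneg _
  set J : F → ℝ := fun t => ∑ x ∈ G.filter (fun x => x.2 ≠ t),
    ‖∑ z : ι → F, starRingEnd ℂ (g (z, t)) *
      e (((2 * (t - x.2))⁻¹ • x.1) ⬝ᵥ z + -(4 * (t - x.2))⁻¹ * (z ⬝ᵥ z))‖ with hJ
  have hslice : ∀ t, J t ≤ 3 * N ^ (3 / 4 : ℝ) *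
      (q ^ ((2 * k + 1 : ℝ) / 4) * ((timeSlice G t).card : ℝ) ^ (3 / 4 : ℝ) +
        q ^ ((3 * k + 2 : ℝ) / 4) * ((timeSlice G t).card : ℝ) ^ (1 / 2 : ℝ)) := by
    intro t
    refine le_rpow_add_rpow_of_pow_four_le hN (Nat.cast_nonneg _) hq ?_
    refine (sum_norm_timeSlice_pow_four_le hF he g G hG hg t).trans ?_
    rw [hι]
    gcongr
    exact rightAngles_le hF he hι _
  have hcard : ((Finset.univ : Finset F).card : ℝ) = q := by rw [Finset.card_univ]
  have h34 : ∑ t : F, ((timeSlice G t).card : ℝ) ^ (3 / 4 : ℝ) ≤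
      q ^ (1 / 4 : ℝ) * N ^ (3 / 4 : ℝ) := by
    have := sum_rpow_le (Finset.univ : Finset F) (fun t => ((timeSlice G t).card : ℝ))
      (fun _ _ => Nat.cast_nonneg _) (θ := 3 / 4) (by norm_num) (by norm_num)
    rw [hcard, sum_card_timeSlice] at this
    norm_num at this ⊢
    exact this
  have h12 : ∑ t : F, ((timeSlice G t).card : ℝ) ^ (1 / 2 : ℝ) ≤
      q ^ (1 / 2 : ℝ) * N ^ (1 / 2 : ℝ) := by
    have := sum_rpow_le (Finset.univ : Finset F) (fun t => ((timeSlice G t).card : ℝ))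
      (fun _ _ => Nat.cast_nonneg _) (θ := 1 / 2) (by norm_num) (by norm_num)
    rw [hcard, sum_card_timeSlice] at this
    norm_num at this ⊢
    exact this
  have hsumJ : ∑ t, J t ≤ 3 * N ^ (3 / 4 : ℝ) *
      (q ^ ((2 * k + 1 : ℝ) / 4) * (q ^ (1 / 4 : ℝ) * N ^ (3 / 4 : ℝ)) +
        q ^ ((3 * k + 2 : ℝ) / 4) * (q ^ (1 / 2 : ℝ) * N ^ (1 / 2 : ℝ))) := by
    refine (Finset.sum_le_sum fun t _ => hslice t).trans ?_
    rw [← Finset.mul_sum, Finset.sum_add_distrib, ← Finset.mul_sum, ← Finset.mul_sum]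
    gcongr
  have hmain := sum_norm_sq_paraboloid_le hF he g G hG hg
  rw [hι] at hmain
  have hsqrt : Real.sqrt q ^ (2 * k + 1) = q ^ ((2 * k + 1 : ℝ) / 2) := by
    rw [Real.sqrt_eq_rpow, ← Real.rpow_natCast, ← Real.rpow_mul hq.le]
    congr 1
    push_cast
    ring
  have hpow : q ^ (2 * k + 1) = q ^ (2 * k + 1 : ℝ) := by
    rw [← Real.rpow_natCast]
    push_cast
    rfl
  have hNa : N ^ (3 / 4 : ℝ) * N ^ (3 / 4 : ℝ) = N ^ (3 / 2 : ℝ) := by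
    rw [← Real.rpow_add_of_nonneg hN (by norm_num) (by norm_num)]
    norm_num
  have hNb : N ^ (3 / 4 : ℝ) * N ^ (1 / 2 : ℝ) = N ^ (5 / 4 : ℝ) := by
    rw [← Real.rpow_add_of_nonneg hN (by norm_num) (by norm_num)]
    norm_num
  have hqa : q ^ (-(2 * k + 1 : ℝ)) * (q ^ ((2 * k + 1 : ℝ) / 2) *
      (q ^ ((2 * k + 1 : ℝ) / 4) * q ^ (1 / 4 : ℝ))) = q ^ (-(k : ℝ) / 2) := by
    rw [← Real.rpow_add hq, ← Real.rpow_add hq, ← Real.rpow_add hq]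
    congr 1
    ring
  have hqb : q ^ (-(2 * k + 1 : ℝ)) * (q ^ ((2 * k + 1 : ℝ) / 2) *
      (q ^ ((3 * k + 2 : ℝ) / 4) * q ^ (1 / 2 : ℝ))) = q ^ ((2 - (k : ℝ)) / 4) := by
    rw [← Real.rpow_add hq, ← Real.rpow_add hq, ← Real.rpow_add hq]
    congr 1
    ring
  calc _ ≤ (q ^ (2 * k + 1))⁻¹ * (4 * q ^ (2 * k + 1) * N +
        2 * Real.sqrt q ^ (2 * k + 1) * (3 * N ^ (3 / 4 : ℝ) *
      (q ^ ((2 * k + 1 : ℝ) / 4) * (q ^ (1 / 4 : ℝ) * N ^ (3 / 4 : ℝ)) +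
        q ^ ((3 * k + 2 : ℝ) / 4) * (q ^ (1 / 2 : ℝ) * N ^ (1 / 2 : ℝ))))) := by
        gcongr
        refine hmain.trans ?_
        gcongr
    _ = 4 * N + (q ^ (2 * k + 1))⁻¹ * (2 * Real.sqrt q ^ (2 * k + 1) * (3 * N ^ (3 / 4 : ℝ) *
      (q ^ ((2 * k + 1 : ℝ) / 4) * (q ^ (1 / 4 : ℝ) * N ^ (3 / 4 : ℝ)) +
        q ^ ((3 * k + 2 : ℝ) / 4) * (q ^ (1 / 2 : ℝ) * N ^ (1 / 2 : ℝ))))) := by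
        rw [mul_add]
        congr 1
        field_simp
    _ = _ := by
        rw [hsqrt, hpow, ← Real.rpow_neg hq.le, ← hNa, ← hNb, ← hqa, ← hqb]
        ring

/-- Let `d ≥ 4` be even. There is `C = C(d) > 0` such that for every finite field `F` of
odd characteristic, every nontrivial additive character `e`, and every `g : F^d → ℂ` with
support `G` satisfying `1/2 ≤ |g| ≤ 2` on `G`,
`‖ĝ‖_{L²(P,dσ)} ≤ C (|G|^{1/2} + |G|^{3/4} |F|^{(2-d)/8} + |F|^{(6-d)/16} |G|^{5/8})`. -/
theorem stmt5 (d : ℕ) (hd : 4 ≤ d) (hdeven : Even d) :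
    ∃ C : ℝ, 0 < C ∧
      ∀ (F : Type) [Field F] [Fintype F], ringChar F ≠ 2 →
      ∀ (e : AddChar F ℂ), e ≠ 1 →
      ∀ g : (Fin (d - 1) → F) × F → ℂ,
      ∀ G : Finset ((Fin (d - 1) → F) × F), (∀ x, x ∈ G ↔ g x ≠ 0) →
        (∀ x ∈ G, 1 / 2 ≤ ‖g x‖ ∧ ‖g x‖ ≤ 2) →
        l2P e g ≤ C * ((G.card : ℝ) ^ ((1 : ℝ) / 2) +
          (G.card : ℝ) ^ ((3 : ℝ) / 4) * (Fintype.card F : ℝ) ^ ((2 - (d : ℝ)) / 8) +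
          (Fintype.card F : ℝ) ^ ((6 - (d : ℝ)) / 16) * (G.card : ℝ) ^ ((5 : ℝ) / 8)) := by
  refine ⟨3, by norm_num, fun F _ _ hF e he g G hG hg => ?_⟩
  obtain ⟨k, hk⟩ : ∃ k, d = 2 * k + 2 := by
    obtain ⟨j, hj⟩ := hdeven
    exact ⟨j - 1, by omega⟩
  have hd1 : d - 1 = 2 * k + 1 := by omega
  have hdk : (d : ℝ) = 2 * k + 2 := by rw [hk]; push_cast; ring
  have h := sum_norm_sq_paraboloid_le_card hF he (k := k) (by simp [hd1]) g G
    (fun x hx => by simpa [hG] using hx) (fun x hx => (hg x hx).2)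
  rw [← hd1] at h
  set q : ℝ := (Fintype.card F : ℝ)
  set N : ℝ := (G.card : ℝ)
  have hq : 0 ≤ q := Nat.cast_nonneg _
  have hN : 0 ≤ N := Nat.cast_nonneg _
  have sq_rpow : ∀ {x : ℝ} (_ : 0 ≤ x) (s r : ℝ), s * 2 = r → (x ^ s) ^ 2 = x ^ r := by
    intro x hx s r hs
    rw [← Real.rpow_natCast (x ^ s) 2, ← Real.rpow_mul hx]
    push_cast
    rw [hs]
  set X := N ^ ((1 : ℝ) / 2) with hX
  set Y := N ^ ((3 : ℝ) / 4) * q ^ ((2 - (d : ℝ)) / 8) with hY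
  set Z := q ^ ((6 - (d : ℝ)) / 16) * N ^ ((5 : ℝ) / 8) with hZ
  have hX0 : 0 ≤ X := by positivity
  have hY0 : 0 ≤ Y := by positivity
  have hZ0 : 0 ≤ Z := by positivity
  have hX2 : X ^ 2 = N := by
    rw [hX, sq_rpow hN _ 1 (by norm_num), Real.rpow_one]
  have hY2 : Y ^ 2 = N ^ (3 / 2 : ℝ) * q ^ (-(k : ℝ) / 2) := by
    rw [hY, mul_pow, sq_rpow hN _ (3 / 2) (by norm_num),
      sq_rpow hq _ (-(k : ℝ) / 2) (by rw [hdk]; ring)]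
  have hZ2 : Z ^ 2 = q ^ ((2 - (k : ℝ)) / 4) * N ^ (5 / 4 : ℝ) := by
    rw [hZ, mul_pow, sq_rpow hN _ (5 / 4) (by norm_num),
      sq_rpow hq _ ((2 - (k : ℝ)) / 4) (by rw [hdk]; ring)]
  rw [← hY2, ← hZ2] at h
  rw [l2P, ← Real.sqrt_eq_rpow]
  refine Real.sqrt_le_iff.mpr ⟨by positivity, le_trans h ?_⟩
  rw [← hX2]
  nlinarith [mul_nonneg hX0 hY0, mul_nonneg hX0 hZ0, mul_nonneg hY0 hZ0, sq_nonneg X,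
    sq_nonneg Y, sq_nonneg Z]
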